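/- For the smoothed weighted coverage f with parameter λ and any finite set Z_i of i elements, the marginal gain of adding v decomposes as Δ(v | Z_i) = Σ_{n=1}^N λ^{m(n)} v^{(n)} − (1 − λ) Σ_{n=1}^N R^{(n)}, where m(n) is the sorted insertion position of v^{(n)} among the n-th coordinates of Z_i and R^{(n)} = Σ_{l > m(n)} λ^{l−1} z_l^{(n)} is the λ-weighted tail of values below v^{(n)}. -/

import Mathlib

/-- Sort the values of a multiset of reals in nonincreasing order. -/
noncomputable def descSort (s : Multiset ℝ) : List ℝ :=
  (s.sort (· ≤ ·)).reverse

/-- `∑_j λ^j * l_j` for a list `l` (0-based exponents). -/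
noncomputable def smoothSum (lam : ℝ) (l : List ℝ) : ℝ :=
  ∑ j ∈ Finset.range l.length, lam ^ j * l.getD j 0

/-- The smoothed weighted coverage function:
`f(Z) = ∑_{n<N} ∑_j λ^{j} v^{(n)}(z_{g^{(n)}(j)})` where for each aspect `n` the
values `v^{(n)}(z)`, `z ∈ Z`, are sorted nonincreasingly. -/
noncomputable def smoothCov {Ω : Type*} (lam : ℝ) (N : ℕ) (v : Ω → ℕ → ℝ)
    (Z : Finset Ω) : ℝ :=
  ∑ n ∈ Finset.range N, smoothSum lam (descSort (Z.val.map (fun z => v z n)))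

theorem descSort_pairwise (s : Multiset ℝ) : (descSort s).Pairwise (fun x y => y ≤ x) := by
  unfold descSort
  rw [List.pairwise_reverse]
  exact Multiset.pairwise_sort s _

theorem descSort_coe (s : Multiset ℝ) : ((descSort s : List ℝ) : Multiset ℝ) = s := by
  unfold descSort
  rw [Multiset.coe_reverse, Multiset.sort_eq]

theorem descSort_unique (s : Multiset ℝ) (l : List ℝ) (hl : l.Pairwise (fun x y => y ≤ x))
    (h : (l : Multiset ℝ) = s) : descSort s = l := by
  have hp : (descSort s).Perm l := by
    rw [← Multiset.coe_eq_coe, descSort_coe, h]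
  exact hp.eq_of_pairwise (fun a b _ _ h1 h2 => le_antisymm h2 h1) (descSort_pairwise s) hl

theorem smoothSum_cons (lam a : ℝ) (l : List ℝ) :
    smoothSum lam (a :: l) = a + lam * smoothSum lam l := by
  unfold smoothSum
  rw [List.length_cons, Finset.sum_range_succ', Finset.mul_sum, add_comm]
  simp only [List.getD_cons_zero, List.getD_cons_succ, pow_zero, one_mul, pow_succ]
  congr 1
  exact Finset.sum_congr rfl fun i _ => by ring

theorem smoothSum_append (lam : ℝ) (A B : List ℝ) :
    smoothSum lam (A ++ B) = smoothSum lam A + lam ^ A.length * smoothSum lam B := by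
  induction A with
  | nil => simp [smoothSum]
  | cons a A ih =>
    rw [List.cons_append, smoothSum_cons, smoothSum_cons, ih, List.length_cons, pow_succ]
    ring

theorem smoothSum_tail (lam : ℝ) (A B : List ℝ) :
    ∑ t ∈ Finset.Ico A.length (A ++ B).length, lam ^ t * (A ++ B).getD t 0
      = lam ^ A.length * smoothSum lam B := by
  rw [Finset.sum_Ico_eq_sum_range]
  unfold smoothSum
  rw [Finset.mul_sum, List.length_append, Nat.add_sub_cancel_left]
  refine Finset.sum_congr rfl fun i _ => ?_
  rw [List.getD_append_right _ _ _ _ (Nat.le_add_right _ _), Nat.add_sub_cancel_left, pow_add,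
    mul_assoc]

theorem descSort_split (s : Multiset ℝ) (a : ℝ) :
    ∃ A B : List ℝ, descSort s = A ++ B ∧ descSort (a ::ₘ s) = A ++ a :: B ∧
      A.length = s.countP (fun x => a < x) := by
  have hs := descSort_pairwise s
  set A := (descSort s).filter (fun x => decide (a < x)) with hA
  set B := (descSort s).filter (fun x => !decide (a < x)) with hB
  have hperm : (A ++ B).Perm (descSort s) := List.filter_append_perm _ _
  have hAm : ∀ x ∈ A, a < x := fun x hx => by simpa using (List.mem_filter.1 hx).2
  have hBm : ∀ x ∈ B, x ≤ a := fun x hx => by simpa using (List.mem_filter.1 hx).2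
  have hc : ((A ++ B : List ℝ) : Multiset ℝ) = s := by
    rw [Multiset.coe_eq_coe.2 hperm, descSort_coe]
  refine ⟨A, B, ?_, ?_, ?_⟩
  · refine descSort_unique _ _ ?_ hc
    exact List.pairwise_append.2 ⟨hs.filter _, hs.filter _,
      fun x hx y hy => (hBm y hy).trans (hAm x hx).le⟩
  · refine descSort_unique _ _ ?_ ?_
    · refine List.pairwise_append.2 ⟨hs.filter _, List.pairwise_cons.2 ⟨hBm, hs.filter _⟩, ?_⟩
      intro x hx y hy
      rcases List.mem_cons.1 hy with rfl | hy
      · exact (hAm x hx).le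
      · exact (hBm y hy).trans (hAm x hx).le
    · rw [Multiset.coe_eq_coe.2 List.perm_middle, ← Multiset.cons_coe, hc]
  · conv_rhs => rw [← descSort_coe s]
    rw [Multiset.coe_countP, List.countP_eq_length_filter]

open scoped Classical in
/-- the marginal gain of adding `v0` to `Z` decomposes as
`Δ(v0 | Z) = ∑_n λ^{m(n)} v^{(n)}(v0) − (1−λ) ∑_n R^{(n)}`, where
`m(n) = |{z ∈ Z : v^{(n)}(z) > v^{(n)}(v0)}|` is the sorted insertion position
of `v^{(n)}(v0)` and `R^{(n)}` is the `λ`-weighted tail of the sorted values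
lying at positions `≥ m(n)`. -/
theorem smoothCov_marginal_decomposition {Ω : Type*} [DecidableEq Ω] (lam : ℝ)
    (hlam0 : 0 ≤ lam) (hlam1 : lam ≤ 1) (N : ℕ) (v : Ω → ℕ → ℝ)
    (hv : ∀ z n, 0 ≤ v z n) (Z : Finset Ω) (v0 : Ω) (hv0 : v0 ∉ Z) :
    smoothCov lam N v (insert v0 Z) - smoothCov lam N v Z =
      (∑ n ∈ Finset.range N,
        lam ^ (Z.filter fun z => v v0 n < v z n).card * v v0 n)
      - (1 - lam) * ∑ n ∈ Finset.range N,
          ∑ t ∈ Finset.Ico ((Z.filter fun z => v v0 n < v z n).card)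
              (descSort (Z.val.map fun z => v z n)).length,
            lam ^ t * (descSort (Z.val.map fun z => v z n)).getD t 0 := by
  unfold smoothCov
  rw [Finset.mul_sum, ← Finset.sum_sub_distrib, ← Finset.sum_sub_distrib]
  refine Finset.sum_congr rfl fun n _ => ?_
  obtain ⟨A, B, h1, h2, h3⟩ := descSort_split (Z.val.map fun z => v z n) (v v0 n)
  have hcard : (Z.filter fun z => v v0 n < v z n).card = A.length := by
    rw [h3, Multiset.countP_map, Finset.card_def, Finset.filter_val]
  rw [hcard, Finset.insert_val_of_notMem hv0, Multiset.map_cons, h1, h2, smoothSum_tail,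
    smoothSum_append, smoothSum_append, smoothSum_cons]
  ring
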